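/- Let λ ∈ (0,1), let q > p ≥ 2 be integers with (p−1)·log(1/λ) > 1, and let Q > 0 be a real number. With α(s) = s log s, the series Σ_{k=1}^{∞} (1/λ)^{α(kq+1) − α(kq+p)} · (α(kq+p) − α(kq))^{Q/2} converges. -/

import Mathlib

/-- `α(s) = s log s`. -/
noncomputable def alphaF (s : ℝ) : ℝ := s * Real.log s

theorem alphaF_sub_le {a b : ℝ} (ha : 0 < a) (hb : 0 < b) :
    alphaF b - alphaF a ≤ (b - a) * (Real.log b + 1) := by
  have h := Real.log_le_sub_one_of_pos (div_pos hb ha)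
  rw [Real.log_div hb.ne' ha.ne'] at h
  have h2 := mul_le_mul_of_nonneg_left h ha.le
  have h3 : a * (b / a - 1) = b - a := by field_simp
  unfold alphaF
  nlinarith

theorem log_add_one_le_rpow {x e : ℝ} (hx : 1 ≤ x) (he : 0 < e) :
    Real.log x + 1 ≤ (1 / e + 1) * x ^ e := by
  have h1 := Real.log_le_rpow_div (zero_le_one.trans hx) he
  have h2 := Real.one_le_rpow hx he.le
  calc Real.log x + 1 ≤ x ^ e / e + x ^ e := add_le_add h1 h2
    _ = (1 / e + 1) * x ^ e := by ring

/-- The power of the larger increment of `alphaF` is bounded by a power of `x`. -/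
theorem alphaF_add_sub_rpow_le {x y p e r : ℝ} (hx : 1 ≤ x) (hp : 0 ≤ p) (hy : x + p ≤ y)
    (he : 0 < e) (hr : 0 ≤ r) (hnonneg : 0 ≤ alphaF (x + p) - alphaF x) :
    (alphaF (x + p) - alphaF x) ^ r ≤ (p * (1 / e + 1)) ^ r * y ^ (e * r) := by
  have hy0 : 0 ≤ y := by linarith
  rw [Real.rpow_mul hy0, ← Real.mul_rpow (by positivity) (by positivity)]
  refine Real.rpow_le_rpow hnonneg ?_ hr
  calc alphaF (x + p) - alphaF x ≤ (x + p - x) * (Real.log (x + p) + 1) :=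
        alphaF_sub_le (by linarith) (by linarith)
    _ = p * (Real.log (x + p) + 1) := by ring
    _ ≤ p * ((1 / e + 1) * (x + p) ^ e) := by
        gcongr
        exact log_add_one_le_rpow (by linarith) he
    _ ≤ p * (1 / e + 1) * y ^ e := by
        rw [mul_assoc]
        gcongr

/-- The exponential factor is bounded by a negative power of `n`. -/
theorem rpow_alphaF_sub_le {t n x p : ℝ} (ht : 1 < t) (hn : 0 < n) (hnx : n ≤ x) (hp : 1 ≤ p) :
    t ^ (alphaF (x + 1) - alphaF (x + p)) ≤ n ^ (-((p - 1) * Real.log t)) := by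
  have hlog : Real.log n ≤ Real.log (x + 1) := Real.log_le_log hn (by linarith)
  have h := alphaF_sub_le (a := x + p) (b := x + 1) (by linarith) (by linarith)
  rw [Real.rpow_def_of_pos (by linarith), Real.rpow_def_of_pos hn, Real.exp_le_exp]
  calc Real.log t * (alphaF (x + 1) - alphaF (x + p))
      ≤ Real.log t * (-(p - 1) * Real.log n) := by
        refine mul_le_mul_of_nonneg_left ?_ (Real.log_pos ht).le
        nlinarith
    _ = Real.log n * (-((p - 1) * Real.log t)) := by ring

/-- With `λ ∈ (0,1)`, integers `q > p ≥ 2` such that `(p-1) log(1/λ) > 1`, and `Q > 0`,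
the series `Σ_{k=1}^∞ (1/λ)^{α(kq+1) - α(kq+p)} (α(kq+p) - α(kq))^{Q/2}` converges. -/
theorem stmt18 (lam : ℝ) (hlam0 : 0 < lam) (hlam1 : lam < 1)
    (p q : ℕ) (hp2 : 2 ≤ p) (hpq : p < q)
    (hplam : 1 < ((p : ℝ) - 1) * Real.log (1 / lam)) (Q : ℝ) (hQ : 0 < Q) :
    Summable (fun k : ℕ =>
      (1 / lam) ^ (alphaF (((k + 1) * q + 1 : ℕ) : ℝ) - alphaF (((k + 1) * q + p : ℕ) : ℝ)) *
        (alphaF (((k + 1) * q + p : ℕ) : ℝ) - alphaF (((k + 1) * q : ℕ) : ℝ)) ^ (Q / 2)) := by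
  set c : ℝ := ((p : ℝ) - 1) * Real.log (1 / lam) with hc
  set e : ℝ := (c - 1) / Q with he
  have he0 : 0 < e := div_pos (by linarith) hQ
  have hp : (2 : ℝ) ≤ p := by exact_mod_cast hp2
  have hq : (p : ℝ) ≤ q := by exact_mod_cast hpq.le
  have ht : 1 < 1 / lam := (one_lt_div hlam0).2 hlam1
  have hnonneg : ∀ k : ℕ,
      0 ≤ alphaF (((k : ℝ) + 1) * q + p) - alphaF (((k : ℝ) + 1) * q) := by
    intro k
    have hk : 1 ≤ ((k : ℝ) + 1) * q := by nlinarith [(Nat.cast_nonneg k : (0 : ℝ) ≤ k)]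
    have h := alphaF_sub_le (a := ((k : ℝ) + 1) * q + p) (b := ((k : ℝ) + 1) * q)
      (by linarith) (by linarith)
    nlinarith [Real.log_nonneg hk]
  have hsum : Summable (fun k : ℕ => ((p * (1 / e + 1)) ^ (Q / 2) * (2 * q : ℝ) ^ (e * (Q / 2))) *
      ((k + 1 : ℕ) : ℝ) ^ (-((c + 1) / 2))) :=
    (((summable_nat_add_iff 1).2 (Real.summable_nat_rpow.2 (by linarith)))).mul_left _
  refine Summable.of_nonneg_of_le (fun k => ?_) (fun k => ?_) hsum
  · push_cast
    exact mul_nonneg (Real.rpow_nonneg (by positivity) _) (Real.rpow_nonneg (hnonneg k) _)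
  · push_cast
    have hn : (1 : ℝ) ≤ (k : ℝ) + 1 := by simp
    have hnx : (k : ℝ) + 1 ≤ ((k : ℝ) + 1) * q := by nlinarith
    calc _ ≤ ((k : ℝ) + 1) ^ (-c) * ((p * (1 / e + 1)) ^ (Q / 2) *
          (2 * q * ((k : ℝ) + 1)) ^ (e * (Q / 2))) :=
          mul_le_mul (rpow_alphaF_sub_le ht (by linarith) hnx (by linarith))
            (alphaF_add_sub_rpow_le (by linarith) (by linarith) (by nlinarith) he0 (by linarith)
              (hnonneg k)) (Real.rpow_nonneg (hnonneg k) _) (by positivity)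
      _ = ((p * (1 / e + 1)) ^ (Q / 2) * (2 * q : ℝ) ^ (e * (Q / 2))) *
          (((k : ℝ) + 1) ^ (-c) * ((k : ℝ) + 1) ^ (e * (Q / 2))) := by
          rw [Real.mul_rpow (x := 2 * (q : ℝ)) (by positivity) (by positivity)]
          ring
      _ = _ := by
          rw [← Real.rpow_add (by linarith)]
          congr 2
          rw [he]
          field_simp
          ring
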